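/- arXiv:1704.08474 — 5 statements merged into one kernel-verified Lean document; each statement's English description precedes it below -/
import Mathlib

section
/- Let n ≥ 2 be an even integer, p ≥ 1 an integer, and i ∈ {1,2}. Let φ be a graph isomorphism from C1 onto Ci which maps every vertex of C1 having degree 3 in AT(n,p) to a vertex having degree 3 in AT(n,p). Then there exists exactly one graph automorphism φ̄ of AT(n,p) such that φ̄(x) = φ(x) for every vertex x of C1. -/
open SimpleGraph

/-- Base relation for the armchair nanotube `AT(n,p)`: vertices are pairs `(i, j)` with
layer `i ∈ {0, …, p}` and position `j ∈ ℤ/2nℤ`.  `(i,j)` is related to `(i, j+1)`,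
and to `(i+1, j-1)` when `j ≡ 2 (mod 4)`, and to `(i+1, j+1)` when `j ≡ 3 (mod 4)`. -/
def ATRel (n p : ℕ) (u v : Fin (p + 1) × ZMod (2 * n)) : Prop :=
  (u.1 = v.1 ∧ v.2 = u.2 + 1) ∨
    ((u.1 : ℕ) + 1 = (v.1 : ℕ) ∧
      ((u.2.val % 4 = 2 ∧ v.2 = u.2 - 1) ∨ (u.2.val % 4 = 3 ∧ v.2 = u.2 + 1)))

/-- The armchair nanotube `AT(n,p)` as a simple graph. -/
def AT (n p : ℕ) : SimpleGraph (Fin (p + 1) × ZMod (2 * n)) :=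
  SimpleGraph.fromRel (ATRel n p)

/-- `Vset n p k i` is the set `V^k_i` of vertices of type `k` in layer `i` of `AT(n,p)`:
type `0` means `j mod 4 ∈ {0,1}`, type `1` means `j mod 4 ∈ {2,3}`. -/
def Vset (n p : ℕ) (k i : ℕ) : Set (Fin (p + 1) × ZMod (2 * n)) :=
  {v | (v.1 : ℕ) = i ∧ v.2.val % 4 / 2 = k}

/-- The set of vertices of `AT(n,p)` in layer `i` (the vertex set of the induced
cycle `C1` for `i = 0`, and of `C2` for `i = p`). -/
def layer (n p : ℕ) (i : ℕ) : Set (Fin (p + 1) × ZMod (2 * n)) :=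
  {v | (v.1 : ℕ) = i}


/-- Residue mod 4 of a position. -/
def rr (n : ℕ) (h : 4 ∣ 2 * n) : ZMod (2 * n) →+* ZMod 4 := ZMod.castHom h (ZMod 4)

lemma val_mod_iff (n : ℕ) (hn : 2 ≤ n) (h : 4 ∣ 2 * n) (j : ZMod (2 * n)) (k : ℕ) (hk : k < 4) :
    j.val % 4 = k ↔ rr n h j = (k : ZMod 4) := by
  have : NeZero (2 * n) := ⟨by omega⟩
  have : rr n h j = ((j.val : ℕ) : ZMod 4) := by
    simp [rr]
  rw [this, ZMod.natCast_eq_natCast_iff', Nat.mod_eq_of_lt hk]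

/-- upward edge -/
def Up (n p : ℕ) (h : 4 ∣ 2 * n) (u v : Fin (p + 1) × ZMod (2 * n)) : Prop :=
  (u.1 : ℕ) + 1 = (v.1 : ℕ) ∧
      ((rr n h u.2 = 2 ∧ v.2 = u.2 - 1) ∨ (rr n h u.2 = 3 ∧ v.2 = u.2 + 1))

lemma two_ne (n : ℕ) (h : 4 ∣ 2 * n) (j k : ZMod (2 * n)) (e : rr n h j ≠ rr n h k) : j ≠ k := by
  rintro rfl; exact e rfl

lemma adj_iff (n p : ℕ) (hn : 2 ≤ n) (h : 4 ∣ 2 * n) (u v : Fin (p + 1) × ZMod (2 * n)) :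
    (AT n p).Adj u v ↔ (u.1 = v.1 ∧ (v.2 = u.2 + 1 ∨ v.2 = u.2 - 1)) ∨ Up n p h u v ∨ Up n p h v u := by
  have h2 := fun j => val_mod_iff n hn h j 2 (by norm_num)
  have h3 := fun j => val_mod_iff n hn h j 3 (by norm_num)
  have key : ∀ u v : Fin (p + 1) × ZMod (2 * n),
      ATRel n p u v ↔ (u.1 = v.1 ∧ v.2 = u.2 + 1) ∨ Up n p h u v := by
    intro u v
    simp only [ATRel, Up, h2, h3]
    norm_num
  have hne : ∀ j : ZMod (2 * n), j ≠ j + 1 := fun j => two_ne n h _ _ (by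
    rw [map_add, map_one]; generalize rr n h j = x; revert x; decide)
  simp only [AT, fromRel_adj, key]
  constructor
  · rintro ⟨-, (⟨a, b⟩ | b) | (⟨a, b⟩ | b)⟩
    · exact Or.inl ⟨a, Or.inl b⟩
    · exact Or.inr (Or.inl b)
    · exact Or.inl ⟨a.symm, Or.inr (by rw [b]; ring)⟩
    · exact Or.inr (Or.inr b)
  · rintro (⟨a, b | b⟩ | b | b)
    · exact ⟨by rintro rfl; exact hne _ b, Or.inl (Or.inl ⟨a, b⟩)⟩
    · exact ⟨by rintro rfl; exact hne (u.2 - 1) (by linear_combination -b), Or.inr (Or.inl ⟨a.symm, by rw [b]; ring⟩)⟩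
    · exact ⟨by rintro rfl; have := b.1; omega, Or.inl (Or.inr b)⟩
    · exact ⟨by rintro rfl; have := b.1; omega, Or.inr (Or.inr b)⟩

lemma agree_step {V : Type*} {G : SimpleGraph V} (ψ χ : G ≃g G) (v w : V) (hv : ψ v = χ v)
    (hw : G.Adj v w) (hu : ∀ u, G.Adj v u → u ≠ w → ψ u = χ u) : ψ w = χ w := by
  by_contra hc
  have h1 : G.Adj (ψ v) (ψ w) := ψ.map_adj_iff.2 hw
  obtain ⟨u, hu'⟩ := χ.surjective (ψ w)
  rw [hv, ← hu', χ.map_adj_iff] at h1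
  by_cases e : u = w
  · subst e; exact hc hu'.symm
  · exact e (ψ.injective ((hu u h1 e).trans hu'))

lemma z4 (x : ZMod 4) : x = 0 ∨ x = 1 ∨ x = 2 ∨ x = 3 := by revert x; decide

lemma agree (n p : ℕ) (hn : 2 ≤ n) (h : 4 ∣ 2 * n) (ψ χ : AT n p ≃g AT n p)
    (h0 : ∀ j, ψ (0, j) = χ (0, j)) : ψ = χ := by
  have main : ∀ i : ℕ, ∀ hi : i < p + 1, ∀ i' : ℕ, ∀ hi' : i' ≤ i, ∀ j,
      ψ (⟨i', by omega⟩, j) = χ (⟨i', by omega⟩, j) := by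
    intro i
    induction i with
    | zero =>
      intro hi i' hi' j
      obtain rfl : i' = 0 := by omega
      exact h0 j
    | succ i ih =>
      intro hi
      have ih' := ih (by omega)
      -- type 0
      have t0 : ∀ j, rr n h j = 0 ∨ rr n h j = 1 → ψ (⟨i + 1, hi⟩, j) = χ (⟨i + 1, hi⟩, j) := by
        intro j hj
        have : ∃ k, (rr n h k = 2 ∧ j = k - 1) ∨ (rr n h k = 3 ∧ j = k + 1) := by
          rcases hj with hj | hj
          · exact ⟨j - 1, Or.inr ⟨by rw [map_sub, hj, map_one]; decide, by ring⟩⟩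
          · exact ⟨j + 1, Or.inl ⟨by rw [map_add, hj, map_one]; decide, by ring⟩⟩
        obtain ⟨k, hk⟩ := this
        apply agree_step ψ χ (⟨i, by omega⟩, k) _ (ih' i le_rfl k)
        · rw [adj_iff n p hn h]
          exact Or.inr (Or.inl ⟨rfl, hk⟩)
        · rintro ⟨⟨a, ha⟩, b⟩ hab hne
          rw [adj_iff n p hn h] at hab
          rcases hab with ⟨e, -⟩ | ⟨e, e'⟩ | ⟨e, -⟩
          · exact ih' a (by simp at e; omega) b
          · exfalso
            apply hne
            simp only at e e'
            have : b = j := by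
              rcases hk with ⟨q, rfl⟩ | ⟨q, rfl⟩ <;> rw [q] at e' <;> rcases e' with ⟨q', rfl⟩ | ⟨q', rfl⟩
              · rfl
              · exact absurd q' (by decide)
              · exact absurd q' (by decide)
              · rfl
            subst this
            simp [← e]
          · exact ih' a (by simp at e; omega) b
      intro i' hi' j
      rcases Nat.lt_or_ge i' (i + 1) with hlt | hge
      · exact ih' i' (by omega) j
      obtain rfl : i' = i + 1 := by omega
      by_cases hj : rr n h j = 0 ∨ rr n h j = 1
      · exact t0 j hj
      have : ∃ k, (rr n h k = 1 ∧ j = k + 1) ∨ (rr n h k = 0 ∧ j = k - 1) := by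
        rcases z4 (rr n h j) with hj' | hj' | hj' | hj'
        · tauto
        · tauto
        · exact ⟨j - 1, Or.inl ⟨by rw [map_sub, hj', map_one]; decide, by ring⟩⟩
        · exact ⟨j + 1, Or.inr ⟨by rw [map_add, hj', map_one]; decide, by ring⟩⟩
      obtain ⟨k, hk⟩ := this
      apply agree_step ψ χ (⟨i + 1, hi⟩, k) _ (t0 k (by tauto))
      · rw [adj_iff n p hn h]
        exact Or.inl ⟨rfl, by tauto⟩
      · rintro ⟨⟨a, ha⟩, b⟩ hab hne
        rw [adj_iff n p hn h] at hab
        rcases hab with ⟨e, e'⟩ | ⟨e, e'⟩ | ⟨e, -⟩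
        · simp at e e'
          subst e
          apply t0
          rcases hk with ⟨q, rfl⟩ | ⟨q, rfl⟩ <;> rcases e' with rfl | rfl
          · exact absurd rfl hne
          · left; rw [map_sub, q, map_one]; decide
          · right; rw [map_add, q, map_one]; decide
          · exact absurd rfl hne
        · exfalso
          simp only at e'
          rcases hk with ⟨q, -⟩ | ⟨q, -⟩ <;> rw [q] at e' <;> revert e' <;>
            simp only [imp_false, not_or, not_and] <;> constructor <;> 
            intro e <;> exact absurd e (by decide)
        · exact ih' a (by simp at e; omega) b
  ext1 ⟨⟨i, hi⟩, j⟩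
  exact main i hi i le_rfl j

/-- the candidate maps; `s` says whether to flip the layers, `t` whether to reflect. -/
def ff (n p : ℕ) (s t : Bool) (c : ZMod (2 * n)) (u : Fin (p + 1) × ZMod (2 * n)) :
    Fin (p + 1) × ZMod (2 * n) :=
  (if s then u.1.rev else u.1, if t then c - u.2 else c + u.2)

def res (s t : Bool) : ZMod 4 := (if s then 2 else 0) + (if t then 1 else 0)

lemma ff_up (n p : ℕ) (h : 4 ∣ 2 * n) (s t : Bool) (c : ZMod (2 * n)) (hc : rr n h c = res s t)
    (u v) (huv : Up n p h u v) :
    Up n p h (ff n p s t c u) (ff n p s t c v) ∨ Up n p h (ff n p s t c v) (ff n p s t c u) := by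
  obtain ⟨⟨a, ha⟩, b⟩ := u
  obtain ⟨⟨a', ha'⟩, b'⟩ := v
  obtain ⟨e, e'⟩ := huv
  simp only at e e'
  cases s
  · left
    refine ⟨by simpa [ff] using e, ?_⟩
    cases t <;> rcases e' with ⟨q, rfl⟩ | ⟨q, rfl⟩ <;> simp only [ff, Bool.false_eq_true, if_false, if_true, map_add, map_sub, hc, q]
    · left; exact ⟨by decide, by ring⟩
    · right; exact ⟨by decide, by ring⟩
    · right; exact ⟨by decide, by ring⟩
    · left; exact ⟨by decide, by ring⟩
  · right
    refine ⟨by simp [ff]; omega, ?_⟩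
    cases t <;> rcases e' with ⟨q, rfl⟩ | ⟨q, rfl⟩ <;> simp only [ff, Bool.false_eq_true, if_false, if_true, map_add, map_sub, map_one, hc, q]
    · right; exact ⟨by decide, by ring⟩
    · left; exact ⟨by decide, by ring⟩
    · left; exact ⟨by decide, by ring⟩
    · right; exact ⟨by decide, by ring⟩

lemma ff_adj (n p : ℕ) (hn : 2 ≤ n) (h : 4 ∣ 2 * n) (s t : Bool) (c : ZMod (2 * n))
    (hc : rr n h c = res s t) (u v) (huv : (AT n p).Adj u v) :
    (AT n p).Adj (ff n p s t c u) (ff n p s t c v) := by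
  rw [adj_iff n p hn h] at huv ⊢
  rcases huv with ⟨e, e'⟩ | e | e
  · left
    refine ⟨by simp [ff, e], ?_⟩
    cases t <;> rcases e' with q | q <;> simp only [ff, q]
    · left; simp; ring
    · right; simp; ring
    · right; simp; ring
    · left; simp; ring
  · exact Or.inr (ff_up n p h s t c hc _ _ e)
  · exact Or.inr (ff_up n p h s t c hc _ _ e).symm

lemma exists_iso (n p : ℕ) (hn : 2 ≤ n) (h : 4 ∣ 2 * n) (s t : Bool) (c : ZMod (2 * n))
    (hc : rr n h c = res s t) : ∃ ψ : AT n p ≃g AT n p, ∀ u, ψ u = ff n p s t c u := by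
  have inv : ∀ c u, ff n p s t (if t then c else -c) (ff n p s t c u) = u := by
    rintro c ⟨a, b⟩
    cases s <;> cases t <;> simp [ff]
  have inv' : ∀ c u, ff n p s t c (ff n p s t (if t then c else -c) u) = u := by
    rintro c ⟨a, b⟩
    cases s <;> cases t <;> simp [ff]
  have hc' : rr n h (if t then c else -c) = res s t := by
    cases t
    · simp only [Bool.false_eq_true, if_false, map_neg, hc]; clear * -; revert s; decide
    · simpa using hc
  refine ⟨⟨⟨ff n p s t c, ff n p s t (if t then c else -c), inv c, inv' c⟩, ?_⟩, fun u => rfl⟩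
  intro u v
  constructor
  · intro e
    have := ff_adj n p hn h s t _ hc' _ _ e
    simpa only [Equiv.coe_fn_mk, inv] using this
  · exact fun e => ff_adj n p hn h s t c hc u v e

lemma deg_three (n p : ℕ) (hn : 2 ≤ n) (hp : 1 ≤ p) (h : 4 ∣ 2 * n) (j : ZMod (2 * n))
    (hj : rr n h j = 2 ∨ rr n h j = 3) : ((AT n p).neighborSet (0, j)).ncard = 3 := by
  have : ∃ k, ∀ k', ((rr n h j = 2 ∧ k' = j - 1) ∨ (rr n h j = 3 ∧ k' = j + 1)) ↔ k' = k := by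
    rcases hj with hj | hj
    · refine ⟨j - 1, fun k' => ?_⟩
      rw [hj]
      have : (2 : ZMod 4) ≠ 3 := by decide
      simp [this]
    · refine ⟨j + 1, fun k' => ?_⟩
      rw [hj]
      have : (3 : ZMod 4) ≠ 2 := by decide
      simp [this]
  obtain ⟨k, hk⟩ := this
  have hs : (AT n p).neighborSet (0, j) = {((0 : Fin (p + 1)), j + 1), (0, j - 1), (⟨1, by omega⟩, k)} := by
    ext ⟨⟨a, ha⟩, b⟩
    simp only [mem_neighborSet, adj_iff n p hn h, Up, hk, Set.mem_insert_iff, Set.mem_singleton_iff,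
      Prod.mk.injEq, Fin.ext_iff]
    simp
    constructor
    · rintro (⟨rfl, e⟩ | ⟨rfl, e⟩) <;> tauto
    · rintro (⟨rfl, e⟩ | ⟨rfl, e⟩ | ⟨rfl, e⟩) <;> tauto
  rw [hs, Set.ncard_eq_three]
  refine ⟨_, _, _, ?_, ?_, ?_, rfl⟩
  · have : j + 1 ≠ j - 1 := two_ne n h _ _ (by
      rw [map_add, map_sub, map_one]; generalize rr n h j = x; revert x; decide)
    simpa using this
  · simp [Fin.ext_iff]
  · simp [Fin.ext_iff]

lemma deg_two (n p : ℕ) (hn : 2 ≤ n) (h : 4 ∣ 2 * n) (i : Fin (p + 1)) (j : ZMod (2 * n))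
    (hd : ((AT n p).neighborSet (i, j)).ncard = 3) :
    (i = 0 → rr n h j = 2 ∨ rr n h j = 3) ∧ ((i : ℕ) = p → rr n h j = 0 ∨ rr n h j = 1) := by
  have key : ¬ (AT n p).neighborSet (i, j) ⊆ {(i, j + 1), (i, j - 1)} := by
    intro hs
    have := Set.ncard_le_ncard hs (Set.toFinite _)
    have := Set.ncard_insert_le (i, j + 1) {(i, j - 1)}
    rw [Set.ncard_singleton] at this
    omega
  constructor
  · intro hi
    by_contra hc
    apply key
    rintro ⟨a, b⟩ hab
    rw [mem_neighborSet, adj_iff n p hn h] at hab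
    rcases hab with ⟨e, e'⟩ | ⟨e, e'⟩ | ⟨e, -⟩
    · simp only at e e'
      subst e
      rcases e' with rfl | rfl <;> simp
    · exact absurd (e'.imp And.left And.left) hc
    · subst hi; simp at e
  · intro hi
    by_contra hc
    apply key
    rintro ⟨a, b⟩ hab
    rw [mem_neighborSet, adj_iff n p hn h] at hab
    rcases hab with ⟨e, e'⟩ | ⟨e, -⟩ | ⟨e, e'⟩
    · simp only at e e'
      subst e
      rcases e' with rfl | rfl <;> simp
    · have := a.2; simp only at e; omega
    · exfalso; apply hc
      simp only at e'
      rcases e' with ⟨q, rfl⟩ | ⟨q, rfl⟩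
      · right; rw [map_sub, q, map_one]; decide
      · left; rw [map_add, q, map_one]; decide

lemma cyc (n : ℕ) (hn : 2 ≤ n) (h : 4 ∣ 2 * n) (f : ZMod (2 * n) → ZMod (2 * n))
    (hf : Function.Injective f) (hs : ∀ j, f (j + 1) = f j + 1 ∨ f (j + 1) = f j - 1) :
    ∃ t : Bool, ∀ j, f j = if t then f 0 - j else f 0 + j := by
  have : NeZero (2 * n) := ⟨by omega⟩
  have step : ∀ j, f (j + 1 + 1) - f (j + 1) = f (j + 1) - f j := by
    intro j
    have hne : f (j + 1 + 1) ≠ f j := fun e => by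
      have := hf e
      refine two_ne n h _ _ ?_ this
      rw [map_add, map_add, map_one]; generalize rr n h j = x; revert x; decide
    rcases hs j with a | a <;> rcases hs (j + 1) with b | b
    · rw [b, a]; ring
    · exact absurd (by rw [b, a]; ring) hne
    · exact absurd (by rw [b, a]; ring) hne
    · rw [b, a]; ring
  have st : ∀ m : ℕ, f ((m : ZMod (2 * n)) + 1) - f m = f 1 - f 0 := by
    intro m
    induction m with
    | zero => simp
    | succ m ih => push_cast; rw [step, ih]
  have all : ∀ m : ℕ, f m = f 0 + m * (f 1 - f 0) := by
    intro m
    induction m with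
    | zero => simp
    | succ m ih =>
      have := st m
      push_cast
      linear_combination this + ih
  have all' : ∀ j, f j = f 0 + j * (f 1 - f 0) := by
    intro j
    have := all j.val
    rwa [ZMod.natCast_zmod_val] at this
  have h1 := hs 0
  rw [zero_add] at h1
  rcases h1 with e | e
  · refine ⟨false, fun j => ?_⟩
    rw [all' j, e]; simp
  · refine ⟨true, fun j => ?_⟩
    rw [all' j, e]; simp; ring

theorem stmt0 (n p : ℕ) (hn : 2 ≤ n) (hne : Even n) (hp : 1 ≤ p)
    (S : Set (Fin (p + 1) × ZMod (2 * n)))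
    (hS : S = layer n p 0 ∨ S = layer n p p)
    (φ : ((AT n p).induce (layer n p 0)) ≃g ((AT n p).induce S))
    (hdeg : ∀ x : layer n p 0,
      ((AT n p).neighborSet x.1).ncard = 3 → ((AT n p).neighborSet (φ x).1).ncard = 3) :
    ∃! ψ : (AT n p) ≃g (AT n p), ∀ x : layer n p 0, ψ x.1 = (φ x).1 := by
  have h : 4 ∣ 2 * n := by obtain ⟨m, rfl⟩ := hne; exact ⟨m, by ring⟩
  have mem0 : ∀ j : ZMod (2 * n), ((0 : Fin (p + 1)), j) ∈ layer n p 0 := fun j => by simp [layer]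
  have hs : ∃ s : Bool, ∀ x ∈ S, x.1 = if s then (0 : Fin (p + 1)).rev else 0 := by
    rcases hS with rfl | rfl
    · exact ⟨false, fun x hx => Fin.ext hx⟩
    · exact ⟨true, fun x hx => by simpa [layer, Fin.ext_iff] using hx⟩
  obtain ⟨s, hs⟩ := hs
  set g : ZMod (2 * n) → layer n p 0 := fun j => ⟨(0, j), mem0 j⟩ with hg
  set f : ZMod (2 * n) → ZMod (2 * n) := fun j => (φ (g j)).1.2 with hfdef
  have hφ : ∀ j, (φ (g j)).1 = (if s then (0 : Fin (p + 1)).rev else 0, f j) := fun j =>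
    Prod.ext (hs _ (φ (g j)).2) rfl
  have finj : Function.Injective f := by
    intro a b hab
    have : φ (g a) = φ (g b) := Subtype.ext (by rw [hφ, hφ, hab])
    have := congrArg (fun x => x.1.2) (φ.injective this)
    simpa [hg] using this
  have fstep : ∀ j, f (j + 1) = f j + 1 ∨ f (j + 1) = f j - 1 := by
    intro j
    have h1 : ((AT n p).induce (layer n p 0)).Adj (g j) (g (j + 1)) := by
      rw [comap_adj, adj_iff n p hn h]
      exact Or.inl ⟨rfl, Or.inl rfl⟩
    have h2 := φ.map_adj_iff.2 h1
    rw [comap_adj, adj_iff n p hn h] at h2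
    simp only [Function.Embedding.subtype_apply, hφ, Up] at h2
    rcases h2 with ⟨-, e⟩ | ⟨e, -⟩ | ⟨e, -⟩
    · exact e
    · omega
    · omega
  obtain ⟨t, ht⟩ := cyc n hn h f finj fstep
  have ftype : ∀ j, (rr n h j = 2 ∨ rr n h j = 3) →
      (if s then rr n h (f j) = 0 ∨ rr n h (f j) = 1 else rr n h (f j) = 2 ∨ rr n h (f j) = 3) := by
    intro j hj
    have h1 := hdeg (g j) (deg_three n p hn hp h j hj)
    rw [hφ] at h1
    have h2 := deg_two n p hn h _ _ h1
    cases s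
    · simpa using h2.1 (by simp)
    · simpa using h2.2 (by simp)
  have hc : rr n h (f 0) = res s t := by
    have h2 := ftype 2 (Or.inl (map_ofNat _ 2))
    have h3 := ftype 3 (Or.inr (map_ofNat _ 3))
    rw [ht 2] at h2
    rw [ht 3] at h3
    have e2 : rr n h 2 = 2 := map_ofNat _ 2
    have e3 : rr n h 3 = 3 := map_ofNat _ 3
    generalize f 0 = c at h2 h3 ⊢
    cases t <;> simp only [Bool.false_eq_true, if_false, if_true, map_add, map_sub, e2, e3] at h2 h3 <;>
      generalize rr n h c = x at h2 h3 ⊢ <;> clear * - h2 h3 <;> revert x s <;> decide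
  obtain ⟨ψ, hψ⟩ := exists_iso n p hn h s t (f 0) hc
  have hgx : ∀ x : layer n p 0, x = g x.1.2 := by
    intro x
    apply Subtype.ext
    apply Prod.ext
    · exact Fin.ext x.2
    · rfl
  have good : ∀ x : layer n p 0, ψ x.1 = (φ x).1 := by
    intro x
    rw [hgx x, hφ, hψ]
    simp only [ff, hg]
    rw [← ht]
  refine ⟨ψ, good, fun χ hχ => ?_⟩
  apply agree n p hn h
  intro j
  exact (hχ (g j)).trans (good (g j)).symm
end

section
/- Let n ≥ 2 be an even integer and p ≥ 1 an odd integer. The orbits under the natural action of Aut(AT(n,p)) on the vertex set of AT(n,p) are exactly the sets O^0_i = V^0_i ∪ V^1_{p−i} for i ∈ {0,…,(p−1)/2} and O^1_i = V^1_i ∪ V^0_{p−i} for i ∈ {0,…,(p−1)/2}. -/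
open SimpleGraph

/-- residue mod 4 -/
def rz (n : ℕ) (hd : 4 ∣ 2 * n) : ZMod (2 * n) →+* ZMod 4 := ZMod.castHom hd (ZMod 4)

theorem rz_val (n : ℕ) (hn : 2 ≤ n) (hd : 4 ∣ 2 * n) (j : ZMod (2 * n)) :
    j.val % 4 = (rz n hd j).val := by
  haveI : NeZero (2 * n) := ⟨by omega⟩
  have h : rz n hd j = ((j.val : ℕ) : ZMod 4) := by
    conv_lhs => rw [← ZMod.natCast_zmod_val j]
    exact map_natCast _ _
  rw [h, ZMod.val_natCast]

theorem rz_val_eq (n : ℕ) (hn : 2 ≤ n) (hd : 4 ∣ 2 * n) (j : ZMod (2 * n)) :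
    (j.val % 4 = 2 ↔ rz n hd j = 2) ∧ (j.val % 4 = 3 ↔ rz n hd j = 3) := by
  rw [rz_val n hn hd]
  generalize rz n hd j = x
  revert x
  decide

theorem ATRel_iff (n p : ℕ) (hn : 2 ≤ n) (hd : 4 ∣ 2 * n) (u v : Fin (p + 1) × ZMod (2 * n)) :
    ATRel n p u v ↔ (u.1 = v.1 ∧ v.2 = u.2 + 1) ∨
    ((u.1 : ℕ) + 1 = (v.1 : ℕ) ∧
      ((rz n hd u.2 = 2 ∧ v.2 = u.2 - 1) ∨ (rz n hd u.2 = 3 ∧ v.2 = u.2 + 1))) := by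
  unfold ATRel
  rw [(rz_val_eq n hn hd _).1, (rz_val_eq n hn hd _).2]

theorem AT_adj_iff (n p : ℕ) (hn : 2 ≤ n) (u v : Fin (p + 1) × ZMod (2 * n)) :
    (AT n p).Adj u v ↔ ATRel n p u v ∨ ATRel n p v u := by
  haveI : Fact (1 < 2 * n) := ⟨by omega⟩
  unfold AT
  rw [SimpleGraph.fromRel_adj]
  constructor
  · exact fun h => h.2
  · intro h
    refine ⟨?_, h⟩
    rintro rfl
    simp [ATRel] at h

/-- An involution preserving the base relation up to symmetry is an automorphism. -/
def isoOfInvol (n p : ℕ) (hn : 2 ≤ n) (f : Fin (p + 1) × ZMod (2 * n) → Fin (p + 1) × ZMod (2 * n))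
    (hf : ∀ u, f (f u) = u)
    (hr : ∀ u v, ATRel n p u v → ATRel n p (f u) (f v) ∨ ATRel n p (f v) (f u)) :
    AT n p ≃g AT n p where
  toFun := f
  invFun := f
  left_inv := hf
  right_inv := hf
  map_rel_iff' := by
    have key : ∀ u v, (AT n p).Adj u v → (AT n p).Adj (f u) (f v) := by
      intro u v h
      rw [AT_adj_iff n p hn] at h ⊢
      rcases h with h | h
      · exact hr u v h
      · exact (hr v u h).symm
    intro u v
    constructor
    · intro h
      have := key _ _ h
      simpa [hf] using this
    · exact key u v

theorem exists_refl (n p : ℕ) (hn : 2 ≤ n) (hd : 4 ∣ 2 * n) (c : ZMod (2 * n))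
    (hc : rz n hd c = 1) : ∃ α : AT n p ≃g AT n p, ∀ u, α u = (u.1, c - u.2) := by
  refine ⟨isoOfInvol n p hn (fun u => (u.1, c - u.2)) (fun u => by simp) ?_, fun u => rfl⟩
  rintro ⟨i, j⟩ ⟨k, l⟩ h
  rw [ATRel_iff n p hn hd] at h ⊢
  rw [ATRel_iff n p hn hd]
  simp only [map_sub, hc] at h ⊢
  rcases h with ⟨rfl, rfl⟩ | ⟨h1, ⟨h2, rfl⟩ | ⟨h2, rfl⟩⟩
  · right; left; exact ⟨rfl, by ring⟩
  · left; right; exact ⟨h1, Or.inr ⟨by rw [h2]; decide, by ring⟩⟩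
  · left; right; exact ⟨h1, Or.inl ⟨by rw [h2]; decide, by ring⟩⟩

theorem exists_flip (n p : ℕ) (hn : 2 ≤ n) (hd : 4 ∣ 2 * n) (c : ZMod (2 * n))
    (hc : rz n hd c = 3) : ∃ α : AT n p ≃g AT n p, ∀ u, α u = (Fin.rev u.1, c - u.2) := by
  refine ⟨isoOfInvol n p hn (fun u => (Fin.rev u.1, c - u.2)) (fun u => by simp) ?_, fun u => rfl⟩
  rintro ⟨i, j⟩ ⟨k, l⟩ h
  rw [ATRel_iff n p hn hd] at h ⊢
  rw [ATRel_iff n p hn hd]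
  simp only [map_sub, hc] at h ⊢
  have hv : ∀ i k : Fin (p + 1), (i : ℕ) + 1 = k → (k.rev : ℕ) + 1 = i.rev := by
    intro i k h
    rw [Fin.val_rev, Fin.val_rev]
    omega
  rcases h with ⟨rfl, rfl⟩ | ⟨h1, ⟨h2, rfl⟩ | ⟨h2, rfl⟩⟩
  · right; left; exact ⟨rfl, by ring⟩
  · right; right
    refine ⟨hv _ _ h1, Or.inl ⟨?_, by ring⟩⟩
    rw [map_sub, h2, map_one]; decide
  · right; right
    refine ⟨hv _ _ h1, Or.inr ⟨?_, by ring⟩⟩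
    rw [map_add, h2, map_one]; decide

/-- height of a vertex -/
def ht (n p : ℕ) (v : Fin (p + 1) × ZMod (2 * n)) : ℕ := 2 * (v.1 : ℕ) + v.2.val % 4 / 2

/-- distance to the boundary -/
def bd (n p : ℕ) (v : Fin (p + 1) × ZMod (2 * n)) : ℕ := min (ht n p v) (2 * p + 1 - ht n p v)

theorem ht_le (n p : ℕ) (v : Fin (p + 1) × ZMod (2 * n)) : ht n p v ≤ 2 * p + 1 := by
  unfold ht
  have := v.1.2
  omega

theorem ht_rel (n p : ℕ) (hn : 2 ≤ n) (hd : 4 ∣ 2 * n) (u v : Fin (p + 1) × ZMod (2 * n))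
    (h : ATRel n p u v) : ht n p u ≤ ht n p v + 1 ∧ ht n p v ≤ ht n p u + 1 := by
  rw [ATRel_iff n p hn hd] at h
  unfold ht
  rw [rz_val n hn hd, rz_val n hn hd]
  obtain ⟨i, j⟩ := u
  obtain ⟨k, l⟩ := v
  simp only at h ⊢
  rcases h with ⟨rfl, rfl⟩ | ⟨h1, ⟨h2, rfl⟩ | ⟨h2, rfl⟩⟩
  · rw [map_add, map_one]
    have : ∀ x : ZMod 4, x.val / 2 ≤ 1 := by decide
    have h1 := this (rz n hd j)
    have h2 := this (rz n hd j + 1)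
    omega
  · rw [map_sub, map_one, h2]
    have e1 : (2 : ZMod 4).val / 2 = 1 := by decide
    have e2 : ((2 : ZMod 4) - 1).val / 2 = 0 := by decide
    omega
  · rw [map_add, map_one, h2]
    have e1 : (3 : ZMod 4).val / 2 = 1 := by decide
    have e2 : ((3 : ZMod 4) + 1).val / 2 = 0 := by decide
    omega

theorem ht_adj (n p : ℕ) (hn : 2 ≤ n) (hd : 4 ∣ 2 * n) (u v : Fin (p + 1) × ZMod (2 * n))
    (h : (AT n p).Adj u v) : ht n p u ≤ ht n p v + 1 ∧ ht n p v ≤ ht n p u + 1 := by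
  rw [AT_adj_iff n p hn] at h
  rcases h with h | h
  · exact ht_rel n p hn hd u v h
  · exact (ht_rel n p hn hd v u h).symm

theorem adj_succ (n p : ℕ) (hn : 2 ≤ n) (i : Fin (p + 1)) (j : ZMod (2 * n)) :
    (AT n p).Adj (i, j) (i, j + 1) := by
  rw [AT_adj_iff n p hn]; left; left; simp

theorem adj_pred (n p : ℕ) (hn : 2 ≤ n) (i : Fin (p + 1)) (j : ZMod (2 * n)) :
    (AT n p).Adj (i, j) (i, j - 1) := by
  rw [AT_adj_iff n p hn]; right; left; simp

theorem exists_other (n p : ℕ) (hn : 2 ≤ n) (hd : 4 ∣ 2 * n) (i : Fin (p + 1)) (j : ZMod (2 * n))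
    (h : 0 < ht n p (i, j)) (h' : ht n p (i, j) < 2 * p + 1) :
    ∃ w : Fin (p + 1) × ZMod (2 * n), (AT n p).Adj (i, j) w ∧
      (((i : ℕ) + 1 = w.1 ∧ 2 ≤ j.val % 4 ∧ w.2.val % 4 / 2 = 0) ∨
        ((i : ℕ) = w.1 + 1 ∧ j.val % 4 < 2 ∧ w.2.val % 4 / 2 = 1)) := by
  unfold ht at h h'
  rw [rz_val n hn hd] at h h' ⊢
  simp only at h h'
  have hi := i.2
  have hx : rz n hd j = 0 ∨ rz n hd j = 1 ∨ rz n hd j = 2 ∨ rz n hd j = 3 := by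
    generalize rz n hd j = x
    revert x
    decide
  have v0 : (0 : ZMod 4).val = 0 := rfl
  have v1 : (1 : ZMod 4).val = 1 := rfl
  have v2 : (2 : ZMod 4).val = 2 := rfl
  have v3 : (3 : ZMod 4).val = 3 := rfl
  rcases hx with hx | hx | hx | hx <;> rw [hx] at h h'
  · refine ⟨(⟨i - 1, by omega⟩, j - 1), ?_, Or.inr ⟨?_, ?_, ?_⟩⟩
    · rw [AT_adj_iff n p hn, ATRel_iff n p hn hd, ATRel_iff n p hn hd]
      right; right
      refine ⟨?_, Or.inr ⟨?_, by simp⟩⟩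
      · simp only; omega
      · simp only [map_sub, hx, map_one]; decide
    · simp only; omega
    · rw [hx]; decide
    · rw [rz_val n hn hd, map_sub, hx, map_one]; decide
  · refine ⟨(⟨i - 1, by omega⟩, j + 1), ?_, Or.inr ⟨?_, ?_, ?_⟩⟩
    · rw [AT_adj_iff n p hn, ATRel_iff n p hn hd, ATRel_iff n p hn hd]
      right; right
      refine ⟨?_, Or.inl ⟨?_, by simp⟩⟩
      · simp only; omega
      · simp only [map_add, hx, map_one]; decide
    · simp only; omega
    · rw [hx]; decide
    · rw [rz_val n hn hd, map_add, hx, map_one]; decide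
  · refine ⟨(⟨i + 1, by omega⟩, j - 1), ?_, Or.inl ⟨?_, ?_, ?_⟩⟩
    · rw [AT_adj_iff n p hn, ATRel_iff n p hn hd, ATRel_iff n p hn hd]
      left; right
      exact ⟨rfl, Or.inl ⟨hx, rfl⟩⟩
    · rfl
    · rw [hx]; decide
    · rw [rz_val n hn hd, map_sub, hx, map_one]; decide
  · refine ⟨(⟨i + 1, by omega⟩, j + 1), ?_, Or.inl ⟨?_, ?_, ?_⟩⟩
    · rw [AT_adj_iff n p hn, ATRel_iff n p hn hd, ATRel_iff n p hn hd]
      left; right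
      exact ⟨rfl, Or.inr ⟨hx, rfl⟩⟩
    · rfl
    · rw [hx]; decide
    · rw [rz_val n hn hd, map_add, hx, map_one]; decide

/-- an in-layer neighbour of the other type -/
theorem exists_inlayer (n p : ℕ) (hn : 2 ≤ n) (hd : 4 ∣ 2 * n) (i : Fin (p + 1))
    (j : ZMod (2 * n)) : ∃ w : Fin (p + 1) × ZMod (2 * n), (AT n p).Adj (i, j) w ∧
      w.1 = i ∧ w.2.val % 4 / 2 + j.val % 4 / 2 = 1 := by
  have hx : ((rz n hd j + 1).val / 2 + (rz n hd j).val / 2 = 1) ∨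
      ((rz n hd j - 1).val / 2 + (rz n hd j).val / 2 = 1) := by
    generalize rz n hd j = x
    revert x
    decide
  rw [rz_val n hn hd j]
  rcases hx with hx | hx
  · refine ⟨(i, j + 1), adj_succ n p hn i j, rfl, ?_⟩
    rw [rz_val n hn hd, map_add, map_one]; exact hx
  · refine ⟨(i, j - 1), adj_pred n p hn i j, rfl, ?_⟩
    rw [rz_val n hn hd, map_sub, map_one]; exact hx

theorem exists_lower (n p : ℕ) (hn : 2 ≤ n) (hd : 4 ∣ 2 * n) (u : Fin (p + 1) × ZMod (2 * n))
    (h : 0 < bd n p u) : ∃ w, (AT n p).Adj u w ∧ bd n p w + 1 = bd n p u := by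
  obtain ⟨i, j⟩ := u
  have h1 : 0 < ht n p (i, j) := by unfold bd at h; omega
  have h2 : ht n p (i, j) < 2 * p + 1 := by unfold bd at h; omega
  obtain ⟨w, hw, hw'⟩ := exists_other n p hn hd i j h1 h2
  obtain ⟨x, hx, hx1, hx2⟩ := exists_inlayer n p hn hd i j
  have hx1' : (x.1 : ℕ) = i := by rw [hx1]
  have key : bd n p w + 1 = bd n p (i, j) ∨ bd n p x + 1 = bd n p (i, j) := by
    unfold bd ht at *
    simp only at *
    omega
  rcases key with k | k
  · exact ⟨w, hw, k⟩
  · exact ⟨x, hx, k⟩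

theorem bd_adj (n p : ℕ) (hn : 2 ≤ n) (hd : 4 ∣ 2 * n) (u v : Fin (p + 1) × ZMod (2 * n))
    (h : (AT n p).Adj u v) : bd n p u ≤ bd n p v + 1 := by
  have := ht_adj n p hn hd u v h
  unfold bd
  omega

/-- graph-theoretic description of `bd v ≤ k` -/
def Pk {V : Type*} (G : SimpleGraph V) : ℕ → V → Prop
  | 0, v => ∃ a b, ∀ w, G.Adj v w → w = a ∨ w = b
  | k + 1, v => Pk G k v ∨ ∃ w, G.Adj v w ∧ Pk G k w

theorem Pk_map {V : Type*} (G : SimpleGraph V) (α : G ≃g G) (k : ℕ) :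
    ∀ v, Pk G k v → Pk G k (α v) := by
  induction k with
  | zero =>
    rintro v ⟨a, b, h⟩
    refine ⟨α a, α b, fun w hw => ?_⟩
    have h1 : G.Adj v (α.symm w) := by
      rw [← α.map_adj_iff]; simpa using hw
    rcases h _ h1 with h | h
    · left; rw [← h]; simp
    · right; rw [← h]; simp
  | succ k ih =>
    rintro v (h | ⟨w, h, h'⟩)
    · exact Or.inl (ih v h)
    · exact Or.inr ⟨α w, α.map_adj_iff.2 h, ih w h'⟩

theorem P0_iff (n p : ℕ) (hn : 2 ≤ n) (hd : 4 ∣ 2 * n) (v : Fin (p + 1) × ZMod (2 * n)) :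
    Pk (AT n p) 0 v ↔ bd n p v = 0 := by
  obtain ⟨i, j⟩ := v
  constructor
  · rintro ⟨a, b, h⟩
    by_contra hb
    have h1 : 0 < ht n p (i, j) := by unfold bd at hb; omega
    have h2 : ht n p (i, j) < 2 * p + 1 := by unfold bd at hb; omega
    obtain ⟨w, hw, hw'⟩ := exists_other n p hn hd i j h1 h2
    have hne : ∀ l, w ≠ (i, l) := by
      rintro l rfl
      simp at hw'
    have hpm : ((i, j + 1) : Fin (p + 1) × ZMod (2 * n)) ≠ (i, j - 1) := by
      intro e
      have e2 := congrArg (fun x => rz n hd x.2) e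
      simp only [map_add, map_sub, map_one] at e2
      revert e2
      generalize rz n hd j = x
      revert x
      decide
    have ha := h _ (adj_succ n p hn i j)
    have hb := h _ (adj_pred n p hn i j)
    have hc := h _ hw
    have n1 := hne (j + 1)
    have n2 := hne (j - 1)
    rcases ha with ha | ha <;> rcases hb with hb | hb <;> rcases hc with hc | hc <;> simp_all
  · intro hb
    refine ⟨(i, j + 1), (i, j - 1), ?_⟩
    rintro ⟨k, l⟩ hw
    rw [AT_adj_iff n p hn, ATRel, ATRel] at hw
    have hk := k.2
    have hi := i.2
    unfold bd ht at hb
    simp only at hb hw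
    rcases hw with (⟨rfl, rfl⟩ | ⟨h1, h2⟩) | (⟨rfl, rfl⟩ | ⟨h1, h2⟩)
    · simp
    · exfalso; omega
    · simp
    · exfalso
      have hl : rz n hd l = 2 ∧ j = l - 1 ∨ rz n hd l = 3 ∧ j = l + 1 := by
        rwa [(rz_val_eq n hn hd _).1, (rz_val_eq n hn hd _).2] at h2
      have : j.val % 4 / 2 = 0 := by
        rw [rz_val n hn hd]
        rcases hl with ⟨hl, rfl⟩ | ⟨hl, rfl⟩
        · rw [map_sub, map_one, hl]; decide
        · rw [map_add, map_one, hl]; decide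
      omega

theorem Pk_iff (n p : ℕ) (hn : 2 ≤ n) (hd : 4 ∣ 2 * n) (k : ℕ) :
    ∀ v, Pk (AT n p) k v ↔ bd n p v ≤ k := by
  induction k with
  | zero => intro v; rw [P0_iff n p hn hd]; omega
  | succ k ih =>
    intro v
    simp only [Pk, ih]
    constructor
    · rintro (h | ⟨w, h, h'⟩)
      · omega
      · have := bd_adj n p hn hd v w h
        omega
    · intro h
      rcases Nat.eq_zero_or_pos (bd n p v) with h0 | h0
      · left; omega
      · obtain ⟨w, hw, hw'⟩ := exists_lower n p hn hd v h0
        exact Or.inr ⟨w, hw, by omega⟩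

theorem bd_le_map (n p : ℕ) (hn : 2 ≤ n) (hd : 4 ∣ 2 * n) (α : AT n p ≃g AT n p)
    (v : Fin (p + 1) × ZMod (2 * n)) : bd n p (α v) ≤ bd n p v :=
  (Pk_iff n p hn hd _ _).1 (Pk_map _ α _ _ ((Pk_iff n p hn hd _ _).2 le_rfl))

theorem bd_map (n p : ℕ) (hn : 2 ≤ n) (hd : 4 ∣ 2 * n) (α : AT n p ≃g AT n p)
    (v : Fin (p + 1) × ZMod (2 * n)) : bd n p (α v) = bd n p v := by
  apply le_antisymm (bd_le_map n p hn hd α v)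
  have := bd_le_map n p hn hd α.symm (α v)
  simpa using this

theorem exists_aut (n p : ℕ) (hn : 2 ≤ n) (hd : 4 ∣ 2 * n) (u v : Fin (p + 1) × ZMod (2 * n))
    (h : bd n p v = bd n p u) : ∃ α : AT n p ≃g AT n p, α u = v := by
  have hu := ht_le n p u
  have hv := ht_le n p v
  obtain ⟨i, j⟩ := u
  obtain ⟨k, l⟩ := v
  obtain ⟨ρ, hρ⟩ := exists_refl n p hn hd 1 (map_one _)
  have tb : ∀ j : ZMod (2 * n), j.val % 4 / 2 ≤ 1 := fun j => by omega
  have t1 := tb j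
  have t2 := tb l
  have hcase : ((k : ℕ) = i ∧ l.val % 4 / 2 = j.val % 4 / 2) ∨
      ((k : ℕ) = p - i ∧ l.val % 4 / 2 + j.val % 4 / 2 = 1) := by
    have := i.2
    have := k.2
    unfold bd ht at *
    simp only at *
    omega
  rw [rz_val n hn hd, rz_val n hn hd] at hcase
  rcases hcase with ⟨h1, h2⟩ | ⟨h1, h2⟩
  · have hik : k = i := Fin.ext h1
    subst hik
    have hx : rz n hd l + rz n hd j = 1 ∨ rz n hd l + (1 - rz n hd j) = 1 := by
      revert h2
      generalize rz n hd j = x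
      generalize rz n hd l = y
      revert x y
      decide
    rcases hx with hx | hx
    · obtain ⟨α, hα⟩ := exists_refl n p hn hd (l + j) (by rw [map_add, hx])
      exact ⟨α, by rw [hα]; simp⟩
    · obtain ⟨α, hα⟩ := exists_refl n p hn hd (l + (1 - j))
        (by rw [map_add, map_sub, map_one, hx])
      exact ⟨ρ.trans α, by
        change α (ρ _) = _
        rw [hρ, hα]; simp⟩
  · have hik : k = Fin.rev i := Fin.ext (by rw [Fin.val_rev]; omega)
    subst hik
    have hx : rz n hd l + rz n hd j = 3 ∨ rz n hd l + (1 - rz n hd j) = 3 := by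
      revert h2
      generalize rz n hd j = x
      generalize rz n hd l = y
      revert x y
      decide
    rcases hx with hx | hx
    · obtain ⟨α, hα⟩ := exists_flip n p hn hd (l + j) (by rw [map_add, hx])
      exact ⟨α, by rw [hα]; simp⟩
    · obtain ⟨α, hα⟩ := exists_flip n p hn hd (l + (1 - j))
        (by rw [map_add, map_sub, map_one, hx])
      exact ⟨ρ.trans α, by
        change α (ρ _) = _
        rw [hρ, hα]; simp⟩

theorem orbit_eq (n p : ℕ) (hn : 2 ≤ n) (hd : 4 ∣ 2 * n) (u : Fin (p + 1) × ZMod (2 * n)) :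
    Set.range (fun α : (AT n p) ≃g (AT n p) => α u) = {v | bd n p v = bd n p u} := by
  ext v
  constructor
  · rintro ⟨α, rfl⟩
    exact bd_map n p hn hd α u
  · exact exists_aut n p hn hd u v

theorem O0_eq (n p i : ℕ) (hp : 1 ≤ p) (hi : i ≤ (p - 1) / 2) :
    Vset n p 0 i ∪ Vset n p 1 (p - i) = {v | bd n p v = 2 * i} := by
  ext v
  have := v.1.2
  simp only [Vset, Set.mem_union, Set.mem_setOf_eq, bd, ht]
  omega

theorem O1_eq (n p i : ℕ) (hp : 1 ≤ p) (hi : i ≤ (p - 1) / 2) (hpo : Odd p) :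
    Vset n p 1 i ∪ Vset n p 0 (p - i) = {v | bd n p v = 2 * i + 1} := by
  ext v
  have := v.1.2
  obtain ⟨m, hm⟩ := hpo
  simp only [Vset, Set.mem_union, Set.mem_setOf_eq, bd, ht]
  omega

theorem stmt1 (n p : ℕ) (hn : 2 ≤ n) (hne : Even n) (hp : 1 ≤ p) (hpo : Odd p) :
    {S : Set (Fin (p + 1) × ZMod (2 * n)) |
        ∃ u, S = Set.range (fun α : (AT n p) ≃g (AT n p) => α u)} =
      {S | ∃ i ≤ (p - 1) / 2,
        S = Vset n p 0 i ∪ Vset n p 1 (p - i) ∨ S = Vset n p 1 i ∪ Vset n p 0 (p - i)} := by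
  have hd : 4 ∣ 2 * n := by
    obtain ⟨m, hm⟩ := hne
    exact ⟨m, by omega⟩
  have hpo' := hpo
  obtain ⟨m, hm⟩ := hpo'
  ext S
  simp only [Set.mem_setOf_eq, orbit_eq n p hn hd]
  constructor
  · rintro ⟨u, rfl⟩
    have hu := ht_le n p u
    have hb : bd n p u ≤ p := by unfold bd; omega
    refine ⟨bd n p u / 2, by omega, ?_⟩
    rw [O0_eq n p _ hp (by omega), O1_eq n p _ hp (by omega) hpo]
    rcases Nat.even_or_odd' (bd n p u) with ⟨c, hc | hc⟩
    · left
      rw [show 2 * (bd n p u / 2) = bd n p u by omega]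
    · right
      rw [show 2 * (bd n p u / 2) + 1 = bd n p u by omega]
  · rintro ⟨i, hi, h⟩
    rw [O0_eq n p _ hp hi, O1_eq n p _ hp hi hpo] at h
    rcases h with rfl | rfl
    · refine ⟨(⟨i, by omega⟩, 0), ?_⟩
      have : bd n p (⟨i, by omega⟩, 0) = 2 * i := by
        simp only [bd, ht, ZMod.val_zero]
        omega
      rw [this]
    · refine ⟨(⟨i, by omega⟩, 2), ?_⟩
      have h2 : (2 : ZMod (2 * n)).val = 2 := by
        have := ZMod.val_natCast_of_lt (n := 2 * n) (a := 2) (by omega)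
        simpa using this
      have : bd n p (⟨i, by omega⟩, 2) = 2 * i + 1 := by
        simp only [bd, ht, h2]
        omega
      rw [this]
end

section
/- Let n ≥ 2 be an even integer and p ≥ 2 an even integer, and let O_{p/2} = V^0_{p/2} ∪ V^1_{p/2} be the set of all vertices of AT(n,p) in layer p/2. Then W(O_{p/2}) = n³, where distances are taken in AT(n,p). -/
open SimpleGraph

theorem at_adj_up (n p : ℕ) (hn : 2 ≤ n) (i : Fin (p + 1)) (a : ZMod (2 * n)) :
    (AT n p).Adj (i, a) (i, a + 1) := by
  haveI : Fact (1 < 2 * n) := ⟨by omega⟩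
  refine (SimpleGraph.fromRel_adj _ _ _).2 ⟨?_, Or.inl (Or.inl ⟨rfl, rfl⟩)⟩
  intro h
  have h2 := congrArg Prod.snd h
  simp at h2

theorem at_walk (n p : ℕ) (hn : 2 ≤ n) (i : Fin (p + 1)) (a : ZMod (2 * n)) (k : ℕ) :
    ∃ w : (AT n p).Walk (i, a) (i, a + (k : ZMod (2 * n))), w.length = k := by
  induction k with
  | zero => exact ⟨(SimpleGraph.Walk.nil' (i, a)).copy rfl (by simp), by simp⟩
  | succ k ih =>
    obtain ⟨w, hw⟩ := ih
    refine ⟨(w.concat (at_adj_up n p hn i _)).copy rfl (by push_cast; rw [add_assoc]), ?_⟩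
    simp [hw]

theorem at_walk_lower (n p : ℕ) (x y : Fin (p + 1) × ZMod (2 * n)) (w : (AT n p).Walk x y) :
    ∃ k : ℤ, |k| ≤ w.length ∧ y.2 = x.2 + (k : ZMod (2 * n)) := by
  induction w with
  | nil => exact ⟨0, by simp⟩
  | @cons u v t h w ih =>
    obtain ⟨k, hk, e⟩ := ih
    have hs : ∃ s : ℤ, |s| ≤ 1 ∧ v.2 = u.2 + (s : ZMod (2 * n)) := by
      obtain ⟨-, h⟩ := (SimpleGraph.fromRel_adj _ _ _).1 h
      rcases h with (⟨-, h⟩ | ⟨-, ⟨-, h⟩ | ⟨-, h⟩⟩) | (⟨-, h⟩ | ⟨-, ⟨-, h⟩ | ⟨-, h⟩⟩)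
      · exact ⟨1, by simp [h]⟩
      · exact ⟨-1, by simp [h, sub_eq_add_neg]⟩
      · exact ⟨1, by simp [h]⟩
      · exact ⟨-1, by simp [h]⟩
      · exact ⟨1, by simp [h]⟩
      · exact ⟨-1, by simp [h]⟩
    obtain ⟨s, hs, e'⟩ := hs
    refine ⟨s + k, ?_, by rw [e, e']; push_cast; ring⟩
    have := abs_add_le s k
    rw [SimpleGraph.Walk.length_cons]
    push_cast
    linarith

theorem at_dist (n p : ℕ) (hn : 2 ≤ n) (i : Fin (p + 1)) (a z : ZMod (2 * n)) :
    (AT n p).dist (i, a) (i, a + z) = min z.val (2 * n - z.val) := by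
  haveI : NeZero (2 * n) := ⟨by omega⟩
  have hz : z.val < 2 * n := ZMod.val_lt z
  obtain ⟨w1, h1⟩ := at_walk n p hn i a z.val
  obtain ⟨w2, h2⟩ := at_walk n p hn i (a + z) (2 * n - z.val)
  have e1 : a + ((z.val : ℕ) : ZMod (2 * n)) = a + z := by simp
  have e2 : a + z + ((2 * n - z.val : ℕ) : ZMod (2 * n)) = a := by
    rw [Nat.cast_sub hz.le, ZMod.natCast_self]; simp
  apply le_antisymm
  · apply le_min
    · have := SimpleGraph.dist_le w1
      rwa [h1, e1] at this
    · have := SimpleGraph.dist_le w2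
      rwa [h2, e2, SimpleGraph.dist_comm] at this
  · have hr : (AT n p).Reachable (i, a) (i, a + z) := by
      have := w1.reachable
      rwa [e1] at this
    obtain ⟨w, hw⟩ := hr.exists_walk_length_eq_dist
    obtain ⟨k, hk, e⟩ := at_walk_lower n p _ _ w
    rw [← hw]
    have e3 : z = (k : ZMod (2 * n)) := by simpa using e
    have e4 : (z.val : ℤ) = k % (2 * n : ℕ) := by rw [e3, ZMod.val_intCast]
    have hd := Int.emod_add_mul_ediv k (2 * n : ℕ)
    rw [← e4] at hd
    rcases le_or_gt 0 k with h0 | h0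
    · have : 0 ≤ ((2 * n : ℕ) : ℤ) * (k / (2 * n : ℕ)) :=
        mul_nonneg (by omega) (Int.ediv_nonneg h0 (by omega))
      rw [abs_of_nonneg h0] at hk
      omega
    · rw [abs_of_neg h0] at hk
      have hq : k / (2 * n : ℕ) ≤ -1 := by
        have := Int.ediv_neg_of_neg_of_pos h0 (b := ((2 * n : ℕ) : ℤ)) (by omega)
        omega
      have : ((2 * n : ℕ) : ℤ) * (k / (2 * n : ℕ)) ≤ (2 * n : ℕ) * (-1) :=
        mul_le_mul_of_nonneg_left hq (by omega)
      omega

theorem sum_min_cycle (n : ℕ) :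
    ∑ k ∈ Finset.range (2 * n), min k (2 * n - k) = n ^ 2 := by
  rw [two_mul, Finset.sum_range_add, ← Finset.sum_add_distrib]
  rw [Finset.sum_congr rfl (g := fun _ => n)]
  · simp [sq]
  · intro k hk
    have := Finset.mem_range.1 hk
    omega

theorem sum_zmod_min (n : ℕ) (hn : 2 ≤ n) [NeZero (2 * n)] :
    ∑ z : ZMod (2 * n), min z.val (2 * n - z.val) = n ^ 2 := by
  rw [← sum_min_cycle n]
  refine Finset.sum_bij (fun z _ => z.val) ?_ ?_ ?_ ?_
  · intro z _
    exact Finset.mem_range.2 (ZMod.val_lt z)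
  · intro a _ b _ h
    exact ZMod.val_injective _ h
  · intro k hk
    exact ⟨(k : ZMod (2 * n)), Finset.mem_univ _, ZMod.val_cast_of_lt (Finset.mem_range.1 hk)⟩
  · intro z _
    rfl

theorem stmt4 (n p : ℕ) (hn : 2 ≤ n) (hne : Even n) (hp : 2 ≤ p) (hpe : Even p) :
    (1 / 2 : ℚ) *
        ∑ᶠ x ∈ Vset n p 0 (p / 2) ∪ Vset n p 1 (p / 2),
          ∑ᶠ y ∈ Vset n p 0 (p / 2) ∪ Vset n p 1 (p / 2), ((AT n p).dist x y : ℚ) =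
      (n : ℚ) ^ 3 := by
  haveI : NeZero (2 * n) := ⟨by omega⟩
  let i : Fin (p + 1) := ⟨p / 2, by omega⟩
  have hS : Vset n p 0 (p / 2) ∪ Vset n p 1 (p / 2) =
      Set.range (fun a : ZMod (2 * n) => (i, a)) := by
    ext ⟨j, a⟩
    simp only [Vset, Set.mem_union, Set.mem_ofPred_eq, Set.mem_range, Prod.mk.injEq, i,
      Fin.ext_iff]
    constructor
    · intro h
      exact ⟨a, by omega, rfl⟩
    · rintro ⟨b, h, rfl⟩
      omega
  have hinj : Function.Injective (fun a : ZMod (2 * n) => (i, a)) := fun a b h =>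
    congrArg Prod.snd h
  have key : ∀ a : ZMod (2 * n),
      ∑ b : ZMod (2 * n), ((AT n p).dist (i, a) (i, b) : ℚ) = (n : ℚ) ^ 2 := by
    intro a
    rw [← Equiv.sum_comp (Equiv.addLeft a)]
    simp only [Equiv.coe_addLeft, at_dist n p hn]
    exact_mod_cast sum_zmod_min n hn
  rw [hS, finsum_mem_range hinj, finsum_eq_sum_of_fintype]
  simp only [finsum_mem_range hinj, finsum_eq_sum_of_fintype, key]
  simp [ZMod.card]
  ring
end

section
/- Let n ≥ 4 be an integer divisible by 4 and p ≥ 1 an integer. For every vertex u ∈ V^0_0 of AT(n,p), d(u, V^0_0) = n²/2. -/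
open SimpleGraph

theorem AT_adj_step (n p : ℕ) (hn : 4 ≤ n) (i : Fin (p+1)) (j : ZMod (2*n)) :
    (AT n p).Adj (i, j) (i, j + 1) := by
  have : Fact (1 < 2 * n) := ⟨by omega⟩
  unfold AT
  rw [SimpleGraph.fromRel_adj]
  refine ⟨?_, Or.inl (Or.inl ⟨rfl, rfl⟩)⟩
  intro h
  have h2 := congrArg Prod.snd h
  simp at h2

theorem AT_walk (n p : ℕ) (hn : 4 ≤ n) (i : Fin (p+1)) (j : ZMod (2*n)) (k : ℕ) :
    ∃ w : (AT n p).Walk (i, j) (i, j + k), w.length = k := by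
  induction k with
  | zero => exact ⟨SimpleGraph.Walk.nil.copy rfl (by simp), by simp⟩
  | succ k ih =>
    obtain ⟨w, hw⟩ := ih
    refine ⟨(w.concat (AT_adj_step n p hn i _)).copy rfl (by push_cast; rw [add_assoc]), ?_⟩
    simp [hw]

theorem AT_walk_lower (n p : ℕ) (hn : 4 ≤ n) {x y : Fin (p+1) × ZMod (2*n)}
    (w : (AT n p).Walk x y) : (y.2 - x.2).valMinAbs.natAbs ≤ w.length := by
  have : Fact (1 < 2 * n) := ⟨by omega⟩
  have : NeZero (2 * n) := ⟨by omega⟩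
  have h1 : (1 : ZMod (2*n)).valMinAbs.natAbs ≤ 1 := by
    rw [ZMod.valMinAbs_natAbs_eq_min, ZMod.val_one]; omega
  have h2 : (-1 : ZMod (2*n)).valMinAbs.natAbs ≤ 1 := by
    rw [ZMod.natAbs_valMinAbs_neg]; exact h1
  induction w with
  | nil => simp
  | @cons a b c h w ih =>
    have hab : (b.2 - a.2).valMinAbs.natAbs ≤ 1 := by
      unfold AT at h
      rw [SimpleGraph.fromRel_adj] at h
      obtain ⟨-, h⟩ := h
      have : b.2 - a.2 = 1 ∨ b.2 - a.2 = -1 := by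
        unfold ATRel at h
        rcases h with (⟨-, h⟩ | ⟨-, ⟨-, h⟩ | ⟨-, h⟩⟩) | (⟨-, h⟩ | ⟨-, ⟨-, h⟩ | ⟨-, h⟩⟩) <;>
          rw [h] <;> simp
      rcases this with h | h <;> rw [h] <;> assumption
    have e : c.2 - a.2 = (c.2 - b.2) + (b.2 - a.2) := by ring
    have := ZMod.natAbs_valMinAbs_add_le (c.2 - b.2) (b.2 - a.2)
    rw [e, SimpleGraph.Walk.length_cons]
    omega

theorem AT_dist (n p : ℕ) (hn : 4 ≤ n) (i : Fin (p+1)) (j d : ZMod (2*n)) :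
    (AT n p).dist (i, j) (i, j + d) = min d.val (2 * n - d.val) := by
  have : NeZero (2 * n) := ⟨by omega⟩
  obtain ⟨w, hw⟩ := AT_walk n p hn i j d.val
  obtain ⟨w', hw'⟩ := AT_walk n p hn i (j + d) (2 * n - d.val)
  have e1 : j + (d.val : ZMod (2*n)) = j + d := by simp
  have e2 : j + d + ((2 * n - d.val : ℕ) : ZMod (2*n)) = j := by
    rw [Nat.cast_sub (ZMod.val_lt d).le, ZMod.natCast_self]; simp
  apply le_antisymm
  · apply le_min
    · have := SimpleGraph.dist_le (w.copy rfl (by rw [e1]) : (AT n p).Walk (i, j) (i, j + d))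
      simpa [hw] using this
    · have := SimpleGraph.dist_le (w'.copy rfl (by rw [e2]) : (AT n p).Walk (i, j + d) (i, j))
      rw [SimpleGraph.dist_comm]
      simpa [hw'] using this
  · have hr : (AT n p).Reachable (i, j) (i, j + d) := ⟨w.copy rfl (by rw [e1])⟩
    obtain ⟨v, hv⟩ := hr.exists_walk_length_eq_dist
    have := AT_walk_lower n p hn v
    rw [hv] at this
    simpa [ZMod.valMinAbs_natAbs_eq_min] using this

theorem AT_dist_sub (n p : ℕ) (hn : 4 ≤ n) (i : Fin (p+1)) (j d : ZMod (2*n)) :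
    (AT n p).dist (i, j) (i, j - d) = min d.val (2 * n - d.val) := by
  have := AT_dist n p hn i (j - d) d
  rwa [sub_add_cancel, SimpleGraph.dist_comm] at this

theorem sum_zmod_range (N : ℕ) [NeZero N] (F : ℕ → ℚ) :
    ∑ d : ZMod N, F d.val = ∑ i ∈ Finset.range N, F i := by
  cases N with
  | zero => exact absurd rfl (NeZero.ne 0)
  | succ k => exact Fin.sum_univ_eq_sum_range F (k + 1)

theorem sum_range_four (g : ℕ → ℚ) (k : ℕ) :
    ∑ i ∈ Finset.range (4 * k), g i =
      ∑ q ∈ Finset.range k, (g (4*q) + g (4*q+1) + g (4*q+2) + g (4*q+3)) := by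
  induction k with
  | zero => simp
  | succ k ih =>
    rw [Finset.sum_range_succ, ← ih, show 4 * (k+1) = 4*k+1+1+1+1 by ring]
    simp only [Finset.sum_range_succ]
    ring

theorem sum_type0 (m : ℕ) :
    ∑ i ∈ Finset.range (2 * (4 * m)),
      (if i % 4 / 2 = 0 then ((min i (2 * (4 * m) - i) : ℕ) : ℚ) else 0) = 8 * (m : ℚ) ^ 2 := by
  rw [show 2 * (4 * m) = 4 * (m + m) by ring, sum_range_four, Finset.sum_range_add,
    ← Finset.sum_add_distrib]
  rw [Finset.sum_congr rfl (g := fun _ => (8 * m : ℚ))]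
  · simp; ring
  · intro q hq
    rw [Finset.mem_range] at hq
    rw [if_pos (by omega), if_pos (by omega), if_neg (by omega), if_neg (by omega),
      if_pos (by omega), if_pos (by omega), if_neg (by omega), if_neg (by omega)]
    simp only [add_zero]
    norm_cast
    omega

theorem sum_of_param (n p : ℕ) (hn : 4 ≤ n) (hn4 : 4 ∣ n)
    (u : Fin (p + 1) × ZMod (2 * n)) (f : ZMod (2*n) → ZMod (2*n))
    (hf : Function.Bijective f)
    (hmod : ∀ d, (f d).val % 4 / 2 = 0 ↔ d.val % 4 / 2 = 0)
    (hd : ∀ d, (AT n p).dist u (0, f d) = min d.val (2 * n - d.val)) :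
    ∑ᶠ y ∈ Vset n p 0 0, ((AT n p).dist u y : ℚ) = (n : ℚ) ^ 2 / 2 := by
  have : NeZero (2 * n) := ⟨by omega⟩
  have himg : Vset n p 0 0 = (fun d => ((0 : Fin (p+1)), f d)) '' {d | d.val % 4 / 2 = 0} := by
    ext ⟨i, j⟩
    simp only [Vset, Set.mem_ofPred_eq, Set.mem_image, Prod.mk.injEq]
    constructor
    · rintro ⟨h1, h2⟩
      obtain ⟨d, rfl⟩ := hf.2 j
      exact ⟨d, (hmod d).1 h2, by ext; simp [h1], rfl⟩
    · rintro ⟨d, h1, rfl, rfl⟩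
      exact ⟨by simp, (hmod d).2 h1⟩
  rw [himg, finsum_mem_image (by
    intro a _ b _ h
    exact hf.1 (congrArg Prod.snd h)), finsum_mem_def, finsum_eq_sum_of_fintype]
  simp only [hd]
  obtain ⟨m, rfl⟩ := hn4
  have := sum_zmod_range (2 * (4 * m)) (fun i =>
    if i % 4 / 2 = 0 then ((min i (2 * (4 * m) - i) : ℕ) : ℚ) else 0)
  rw [sum_type0] at this
  rw [show ((4 * m : ℕ) : ℚ)^2 / 2 = 8 * (m : ℚ)^2 by push_cast; ring, ← this]
  refine Finset.sum_congr rfl fun d _ => ?_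
  simp only [Set.indicator_apply, Set.mem_ofPred_eq]

theorem stmt5 (n p : ℕ) (hn : 4 ≤ n) (hn4 : 4 ∣ n) (hp : 1 ≤ p)
    (u : Fin (p + 1) × ZMod (2 * n)) (hu : u ∈ Vset n p 0 0) :
    ∑ᶠ y ∈ Vset n p 0 0, ((AT n p).dist u y : ℚ) = (n : ℚ) ^ 2 / 2 := by
  have : NeZero (2 * n) := ⟨by omega⟩
  obtain ⟨i, a⟩ := u
  obtain ⟨h1, h2⟩ := hu
  have hi : i = 0 := by ext; simpa using h1
  subst hi
  simp only at h2
  have hval : ∀ x y : ZMod (2*n), (x + y).val % 4 = (x.val + y.val) % 4 := by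
    intro x y
    rw [ZMod.val_add, Nat.mod_mod_of_dvd _ (Dvd.dvd.mul_left hn4 2)]
  rcases (show a.val % 4 = 0 ∨ a.val % 4 = 1 by omega) with ha | ha
  · refine sum_of_param n p hn hn4 _ (fun d => a + d) (AddGroup.addLeft_bijective a) ?_
      (AT_dist n p hn 0 a)
    intro d
    have := hval a d
    omega
  · refine sum_of_param n p hn hn4 _ (fun d => a - d) (Equiv.subLeft a).bijective ?_
      (AT_dist_sub n p hn 0 a)
    intro d
    have := hval (a - d) d
    rw [sub_add_cancel] at this
    omega
end

section
/- Let n be an integer divisible by 4 and p ≥ 1 an integer with n > 4p + 4. For every vertex u ∈ V^0_0 of AT(n,p), d(u, V^1_p) = n²/2 + 4p² + 4p. -/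
open SimpleGraph

/-- Distance function on the universal cover, from base position `b` in layer `0`. -/
def FF (b : ℤ) (i : ℕ) (x : ℤ) : ℤ := |x - b| + 2 * max 0 ((i : ℤ) - max (x / 4) ((1 - x) / 4))

lemma FF_pos (b : ℤ) (hb : b = 0 ∨ b = 1) (i : ℕ) (x : ℤ) (hx : 1 ≤ x) :
    FF b i x = x - b + 2 * max 0 ((i : ℤ) - x / 4) := by
  unfold FF
  rw [abs_of_nonneg (by omega), max_eq_left (by omega : (1 - x) / 4 ≤ x / 4)]

lemma FF_neg (b : ℤ) (hb : b = 0 ∨ b = 1) (i : ℕ) (x : ℤ) (hx : x ≤ 0) :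
    FF b i x = b - x + 2 * max 0 ((i : ℤ) - (1 - x) / 4) := by
  unfold FF
  rw [abs_of_nonpos (by omega), max_eq_right (by omega : x / 4 ≤ (1 - x) / 4)]
  ring

lemma FF_lip_h (b : ℤ) (hb : b = 0 ∨ b = 1) (i : ℕ) (x x' : ℤ) (hx : x' = x + 1 ∨ x' = x - 1) :
    FF b i x' ≤ FF b i x + 1 := by
  rcases le_or_gt x 0 with h | h <;> rcases le_or_gt x' 0 with h' | h'
  · rw [FF_neg b hb i x h, FF_neg b hb i x' h']; omega
  · rw [FF_neg b hb i x h, FF_pos b hb i x' h']; omega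
  · rw [FF_pos b hb i x h, FF_neg b hb i x' h']; omega
  · rw [FF_pos b hb i x h, FF_pos b hb i x' h']; omega

lemma FF_lip_v (b : ℤ) (hb : b = 0 ∨ b = 1) (i : ℕ) (x x' : ℤ)
    (hx : (x % 4 = 2 ∧ x' = x - 1) ∨ (x % 4 = 3 ∧ x' = x + 1)) :
    FF b (i + 1) x' ≤ FF b i x + 1 ∧ FF b i x ≤ FF b (i + 1) x' + 1 := by
  rcases le_or_gt x 0 with h | h <;> rcases le_or_gt x' 0 with h' | h'
  · rw [FF_neg b hb i x h, FF_neg b hb _ x' h']; push_cast; omega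
  · omega
  · omega
  · rw [FF_pos b hb i x h, FF_pos b hb _ x' h']; push_cast; omega

lemma FF_pred (b : ℤ) (hb : b = 0 ∨ b = 1) (i : ℕ) (x : ℤ) (h0 : 0 < FF b i x) :
    FF b i (x - 1) + 1 ≤ FF b i x ∨ FF b i (x + 1) + 1 ≤ FF b i x ∨
      ∃ i' : ℕ, i = i' + 1 ∧ ((x % 4 = 0 ∧ FF b i' (x - 1) + 1 ≤ FF b i x) ∨
        (x % 4 = 1 ∧ FF b i' (x + 1) + 1 ≤ FF b i x)) := by
  rcases le_or_gt x 0 with h | h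
  · by_cases hc : x % 4 = 1 ∧ (1 - x) / 4 ≤ i
    · right; right
      refine ⟨i - 1, by omega, Or.inr ⟨hc.1, ?_⟩⟩
      rw [FF_neg b hb i x h, FF_neg b hb _ (x + 1) (by omega)]; omega
    · by_cases hx0 : x = 0
      · subst hx0
        by_cases hi : i = 0
        · right; left
          subst hi
          rw [FF_neg b hb _ 0 h] at *
          rw [FF_pos b hb _ (0 + 1) (by omega)]; omega
        · right; right
          refine ⟨i - 1, by omega, Or.inl ⟨rfl, ?_⟩⟩
          rw [FF_neg b hb i 0 h, FF_neg b hb _ (0 - 1) (by omega)]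
          omega
      · right; left
        rw [FF_neg b hb i x h, FF_neg b hb _ (x + 1) (by omega)]; omega
  · by_cases hc : x % 4 = 0 ∧ x / 4 ≤ i
    · right; right
      refine ⟨i - 1, by omega, Or.inl ⟨hc.1, ?_⟩⟩
      rw [FF_pos b hb i x h, FF_pos b hb _ (x - 1) (by omega)]; omega
    · by_cases hx0 : x = 1
      · subst hx0
        by_cases hi : i = 0
        · left
          subst hi
          rw [FF_pos b hb _ 1 h] at *
          rw [FF_neg b hb _ (1 - 1) (by omega)]; omega
        · right; right
          refine ⟨i - 1, by omega, Or.inr ⟨rfl, ?_⟩⟩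
          rw [FF_pos b hb i 1 h, FF_pos b hb _ (1 + 1) (by omega)]
          omega
      · left
        rw [FF_pos b hb i x h, FF_pos b hb _ (x - 1) (by omega)]; omega

lemma val_mod_four (n : ℕ) (hn : 0 < n) (h2 : 2 ∣ n) (z : ℤ) :
    ((((z : ℤ) : ZMod (2 * n)).val : ℕ) : ℤ) % 4 = z % 4 := by
  have : NeZero (2 * n) := ⟨by omega⟩
  rw [ZMod.val_intCast]
  apply Int.emod_emod_of_dvd
  obtain ⟨k, rfl⟩ := h2
  exact ⟨k, by push_cast; ring⟩

lemma adj_h (n p : ℕ) (hn : 0 < n) (i : Fin (p + 1)) (z z' : ℤ) (hz : z' = z + 1) :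
    (AT n p).Adj (i, (z : ZMod (2 * n))) (i, (z' : ZMod (2 * n))) := by
  have : Fact (1 < 2 * n) := ⟨by omega⟩
  subst hz
  refine ⟨?_, Or.inl (Or.inl ⟨rfl, by push_cast; rfl⟩)⟩
  intro h
  have := congrArg Prod.snd h
  simp at this

lemma adj_v (n p : ℕ) (hn : 0 < n) (h2 : 2 ∣ n) (i i' : Fin (p + 1)) (hi : (i : ℕ) + 1 = i')
    (z z' : ℤ) (hz : (z % 4 = 2 ∧ z' = z - 1) ∨ (z % 4 = 3 ∧ z' = z + 1)) :
    (AT n p).Adj (i, (z : ZMod (2 * n))) (i', (z' : ZMod (2 * n))) := by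
  have hv := val_mod_four n hn h2 z
  refine ⟨?_, Or.inl (Or.inr ⟨hi, ?_⟩)⟩
  · intro h
    have := congrArg (fun q => (q.1 : ℕ)) h
    simp at this
    omega
  · rcases hz with ⟨h, rfl⟩ | ⟨h, rfl⟩
    · left
      exact ⟨by simp only; omega, by push_cast; rfl⟩
    · right
      exact ⟨by simp only; omega, by push_cast; rfl⟩

lemma step_lower (n p : ℕ) (hn : 0 < n) (h2 : 2 ∣ n) (a b : ℤ) (hb : b = 0 ∨ b = 1)
    (y z : Fin (p + 1) × ZMod (2 * n)) (h : (AT n p).Adj y z) (x : ℤ)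
    (hx : y.2 = ((4 * a + x : ℤ) : ZMod (2 * n))) :
    ∃ x' : ℤ, z.2 = ((4 * a + x' : ℤ) : ZMod (2 * n)) ∧ FF b z.1 x' ≤ FF b y.1 x + 1 := by
  have key : ∀ x' : ℤ, z.2 = ((4 * a + x' : ℤ) : ZMod (2 * n)) → ((z.2.val : ℕ) : ℤ) % 4 = x' % 4 := by
    intro x' h'
    rw [h', val_mod_four n hn h2]; omega
  have keyy : ((y.2.val : ℕ) : ℤ) % 4 = x % 4 := by
    rw [hx, val_mod_four n hn h2]; omega
  obtain ⟨-, (⟨h1, h3⟩ | ⟨h1, (⟨h4, h3⟩ | ⟨h4, h3⟩)⟩) | (⟨h1, h3⟩ | ⟨h1, (⟨h4, h3⟩ | ⟨h4, h3⟩)⟩)⟩ := h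
  · refine ⟨x + 1, by rw [h3, hx]; push_cast; ring, ?_⟩
    rw [← h1]; exact FF_lip_h b hb _ _ _ (Or.inl rfl)
  · refine ⟨x - 1, by rw [h3, hx]; push_cast; ring, ?_⟩
    rw [← h1]; exact (FF_lip_v b hb _ _ _ (Or.inl ⟨by omega, rfl⟩)).1
  · refine ⟨x + 1, by rw [h3, hx]; push_cast; ring, ?_⟩
    rw [← h1]; exact (FF_lip_v b hb _ _ _ (Or.inr ⟨by omega, rfl⟩)).1
  · have e : z.2 = ((4 * a + (x - 1) : ℤ) : ZMod (2 * n)) := by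
      rw [hx] at h3; rw [eq_sub_of_add_eq h3.symm]; push_cast; ring
    refine ⟨x - 1, e, ?_⟩
    rw [h1]; exact FF_lip_h b hb _ _ _ (Or.inr rfl)
  · have e : z.2 = ((4 * a + (x + 1) : ℤ) : ZMod (2 * n)) := by
      rw [hx] at h3; rw [sub_eq_iff_eq_add.mp h3.symm]; push_cast; ring
    have := key _ e
    refine ⟨x + 1, e, ?_⟩
    rw [← h1]; exact (FF_lip_v b hb _ _ _ (Or.inl ⟨by omega, by ring⟩)).2
  · have e : z.2 = ((4 * a + (x - 1) : ℤ) : ZMod (2 * n)) := by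
      rw [hx] at h3; rw [eq_sub_of_add_eq h3.symm]; push_cast; ring
    have := key _ e
    refine ⟨x - 1, e, ?_⟩
    rw [← h1]; exact (FF_lip_v b hb _ _ _ (Or.inr ⟨by omega, by ring⟩)).2

lemma walk_lower (n p : ℕ) (hn : 0 < n) (h2 : 2 ∣ n) (a b : ℤ) (hb : b = 0 ∨ b = 1)
    (y z : Fin (p + 1) × ZMod (2 * n)) (w : (AT n p).Walk y z) : ∀ (x : ℤ)
    (_ : y.2 = ((4 * a + x : ℤ) : ZMod (2 * n))),
    ∃ x' : ℤ, z.2 = ((4 * a + x' : ℤ) : ZMod (2 * n)) ∧ FF b z.1 x' ≤ FF b y.1 x + w.length := by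
  induction w with
  | nil => intro x hx; exact ⟨x, hx, by simp⟩
  | cons h w ih =>
    intro x hx
    obtain ⟨x1, h1, h1'⟩ := step_lower n p hn h2 a b hb _ _ h x hx
    obtain ⟨x2, h3, h3'⟩ := ih x1 h1
    refine ⟨x2, h3, ?_⟩
    rw [SimpleGraph.Walk.length_cons]
    push_cast
    linarith

lemma walk_upper (n p : ℕ) (hn : 0 < n) (h2 : 2 ∣ n) (a b : ℤ) (hb : b = 0 ∨ b = 1) (N : ℕ) :
    ∀ (i : Fin (p + 1)) (x : ℤ), FF b i x ≤ N →
    ∃ w : (AT n p).Walk (0, ((4 * a + b : ℤ) : ZMod (2 * n))) (i, ((4 * a + x : ℤ) : ZMod (2 * n))),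
      w.length ≤ N := by
  induction N with
  | zero =>
    intro i x h
    have : (i : ℕ) = 0 ∧ x = b := by
      unfold FF at h; rw [abs] at h; omega
    obtain ⟨h1, rfl⟩ := this
    obtain rfl : i = 0 := Fin.ext h1
    exact ⟨SimpleGraph.Walk.nil, by simp⟩
  | succ N ih =>
    intro i x h
    have step : ∀ (i' : Fin (p + 1)) (x' : ℤ), FF b i' x' ≤ N →
        (AT n p).Adj (i', ((4 * a + x' : ℤ) : ZMod (2 * n))) (i, ((4 * a + x : ℤ) : ZMod (2 * n))) →
        ∃ w : (AT n p).Walk (0, ((4 * a + b : ℤ) : ZMod (2 * n)))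
          (i, ((4 * a + x : ℤ) : ZMod (2 * n))), w.length ≤ N + 1 := by
      intro i' x' hF hA
      obtain ⟨w, hw⟩ := ih i' x' hF
      exact ⟨w.concat hA, by rw [SimpleGraph.Walk.length_concat]; omega⟩
    by_cases hle : FF b i x ≤ N
    · obtain ⟨w, hw⟩ := ih i x hle
      exact ⟨w, by omega⟩
    rcases FF_pred b hb i x (by omega) with hl | hr | ⟨i', hi', ⟨h4, hl⟩ | ⟨h4, hr⟩⟩
    · exact step i (x - 1) (by omega) (adj_h n p hn i _ _ (by ring))
    · exact step i (x + 1) (by omega) (adj_h n p hn i _ _ (by ring)).symm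
    · have hip := i.isLt
      exact step ⟨i', by omega⟩ (x - 1) (by simp only; omega)
        (adj_v n p hn h2 _ i hi'.symm _ _ (Or.inr ⟨by omega, by ring⟩))
    · have hip := i.isLt
      exact step ⟨i', by omega⟩ (x + 1) (by simp only; omega)
        (adj_v n p hn h2 _ i hi'.symm _ _ (Or.inl ⟨by omega, by ring⟩))

lemma dist_eq (n p m : ℕ) (hnm : n = 4 * m) (hgt : 4 * p + 4 < n) (a b : ℤ) (hb : b = 0 ∨ b = 1)
    (x : ℤ) (hx : -(n : ℤ) < x ∧ x < n) :
    (((AT n p).dist (0, ((4 * a + b : ℤ) : ZMod (2 * n)))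
      (Fin.last p, ((4 * a + x : ℤ) : ZMod (2 * n))) : ℕ) : ℤ) = FF b p x := by
  have h2 : 2 ∣ n := ⟨2 * m, by omega⟩
  have hF : 0 ≤ FF b p x := by unfold FF; rw [abs]; omega
  obtain ⟨N, hN⟩ := Int.eq_ofNat_of_zero_le hF
  obtain ⟨w, hw⟩ := walk_upper n p (by omega) h2 a b hb N (Fin.last p) x (by simp [hN])
  apply le_antisymm
  · rw [hN]
    exact_mod_cast (SimpleGraph.dist_le w).trans hw
  · obtain ⟨w', hw'⟩ := (SimpleGraph.Walk.reachable w).exists_walk_length_eq_dist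
    obtain ⟨x', h1, h3⟩ := walk_lower n p (by omega) h2 a b hb _ _ w' b rfl
    rw [hw'] at h3
    have hb0 : FF b ((0 : Fin (p + 1)) : ℕ) b = 0 := by
      unfold FF; rw [abs]; simp only [Fin.val_zero]; omega
    simp only [hb0, Fin.val_last, zero_add] at h3
    refine le_trans ?_ h3
    simp only at h1
    rw [ZMod.intCast_eq_intCast_iff_dvd_sub] at h1
    obtain ⟨k, hk⟩ := h1
    push_cast at hk
    have hk' : x' = x + 2 * ((n : ℤ) * k) := by linarith
    rcases lt_trichotomy k 0 with h | h | h
    · have : (n : ℤ) * k ≤ -n := by nlinarith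
      unfold FF; rw [abs, abs]; omega
    · subst h; simp at hk'; rw [hk']
    · have : (n : ℤ) ≤ n * k := by nlinarith
      unfold FF; rw [abs, abs]; omega

/-- Position (on the universal cover) of the type-1 vertices. -/
def xx (t : ℕ × Bool × Bool) : ℤ :=
  (if t.2.1 then 4 * (t.1 : ℤ) + 2 else -4 * (t.1 : ℤ) - 2) + (if t.2.2 then 1 else 0)

lemma sum_aux (p m : ℕ) (hp : p ≤ m) :
    ∑ l ∈ Finset.range m, (16 * (l : ℤ) + 8 + 8 * max 0 ((p : ℤ) - l)) =
      8 * (m : ℤ) ^ 2 + 4 * p ^ 2 + 4 * p := by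
  have h1 : ∀ q : ℕ, q ≤ p → ∑ l ∈ Finset.range q, (16 * (l : ℤ) + 8 + 8 * max 0 ((p : ℤ) - l)) =
      8 * (q : ℤ) ^ 2 + 4 * q * (2 * p + 1 - q) := by
    intro q
    induction q with
    | zero => intro _; simp
    | succ q ih =>
      intro hq
      rw [Finset.sum_range_succ, ih (by omega), max_eq_right (by omega)]
      push_cast; ring
  induction m, hp using Nat.le_induction with
  | base => rw [h1 p le_rfl]; ring
  | succ m hm ih =>
    rw [Finset.sum_range_succ, ih, max_eq_left (by omega)]
    push_cast; ring

lemma sum_FF (p m : ℕ) (hp : p ≤ m) (b : ℤ) (hb : b = 0 ∨ b = 1) :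
    ∑ t ∈ Finset.range m ×ˢ (Finset.univ : Finset (Bool × Bool)), FF b p (xx t) =
      8 * (m : ℤ) ^ 2 + 4 * p ^ 2 + 4 * p := by
  rw [Finset.sum_product, ← sum_aux p m hp]
  apply Finset.sum_congr rfl
  intro l _
  rw [Fintype.sum_prod_type]
  simp only [Fintype.sum_bool, xx, if_true, Bool.false_eq_true, if_false]
  rw [FF_pos b hb p (4 * (l : ℤ) + 2 + 1) (by omega), FF_pos b hb p (4 * (l : ℤ) + 2 + 0) (by omega),
    FF_neg b hb p (-4 * (l : ℤ) - 2 + 1) (by omega), FF_neg b hb p (-4 * (l : ℤ) - 2 + 0) (by omega)]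
  have e1 : (4 * (l : ℤ) + 2 + 1) / 4 = l := by omega
  have e2 : (4 * (l : ℤ) + 2 + 0) / 4 = l := by omega
  have e3 : (1 - (-4 * (l : ℤ) - 2 + 1)) / 4 = l := by omega
  have e4 : (1 - (-4 * (l : ℤ) - 2 + 0)) / 4 = l := by omega
  rw [e1, e2, e3, e4]
  ring

theorem stmt8 (n p : ℕ) (hn4 : 4 ∣ n) (hp : 1 ≤ p) (hgt : 4 * p + 4 < n)
    (u : Fin (p + 1) × ZMod (2 * n)) (hu : u ∈ Vset n p 0 0) :
    ∑ᶠ y ∈ Vset n p 1 p, ((AT n p).dist u y : ℚ) =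
      (n : ℚ) ^ 2 / 2 + 4 * (p : ℚ) ^ 2 + 4 * (p : ℚ) := by
  obtain ⟨m, hm⟩ := hn4
  have hn : 0 < n := by omega
  have : NeZero (2 * n) := ⟨by omega⟩
  obtain ⟨hu1, hu2⟩ := hu
  obtain ⟨a, b, hb, hab⟩ : ∃ a b : ℤ, (b = 0 ∨ b = 1) ∧ (u.2.val : ℤ) = 4 * a + b :=
    ⟨u.2.val / 4, u.2.val % 4, by omega, by omega⟩
  have hulast : u = (0, ((4 * a + b : ℤ) : ZMod (2 * n))) := by
    refine Prod.ext (Fin.ext hu1) ?_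
    simp only
    rw [← hab]
    simp
  have hub := ZMod.val_lt u.2
  set g : ℕ × Bool × Bool → Fin (p + 1) × ZMod (2 * n) :=
    fun t => (Fin.last p, ((4 * a + xx t : ℤ) : ZMod (2 * n))) with hg
  set S : Finset (ℕ × Bool × Bool) := Finset.range m ×ˢ (Finset.univ : Finset (Bool × Bool)) with hS
  have hbij : Set.BijOn g (S : Set (ℕ × Bool × Bool)) (Vset n p 1 p) := by
    refine ⟨?_, ?_, ?_⟩
    · rintro ⟨l, s, e⟩ ht
      refine ⟨by simp [hg], ?_⟩
      have := val_mod_four n hn ⟨2 * m, by omega⟩ (4 * a + xx (l, s, e))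
      simp only [hg]
      have h3 : xx (l, s, e) % 4 = 2 ∨ xx (l, s, e) % 4 = 3 := by
        cases s <;> cases e <;> simp [xx] <;> omega
      omega
    · rintro ⟨l, s, e⟩ ht ⟨l', s', e'⟩ ht' h
      simp [hS] at ht ht'
      have h' := congrArg Prod.snd h
      simp only [hg] at h'
      rw [ZMod.intCast_eq_intCast_iff_dvd_sub] at h'
      obtain ⟨k, hk⟩ := h'
      push_cast at hk
      have hk' : xx (l', s', e') - xx (l, s, e) = 2 * ((n : ℤ) * k) := by linarith
      have bd : ∀ (l : ℕ) (s e : Bool), l < m → -(n : ℤ) < xx (l, s, e) ∧ xx (l, s, e) < n := by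
        intro l s e hl
        cases s <;> cases e <;> simp [xx] <;> omega
      have b1 := bd l s e ht
      have b2 := bd l' s' e' ht'
      have k0 : k = 0 := by
        rcases lt_trichotomy k 0 with h | h | h
        · have : (n : ℤ) * k ≤ -n := by nlinarith
          omega
        · exact h
        · have : (n : ℤ) ≤ n * k := by nlinarith
          omega
      subst k0
      cases s <;> cases e <;> cases s' <;> cases e' <;> simp [xx] at hk' ⊢ <;> omega
    · rintro ⟨i, z⟩ ⟨hi, hz⟩
      simp only at hi hz
      have hzl := ZMod.val_lt z
      obtain ⟨x, c, hxc, hx1, hx2⟩ : ∃ x c : ℤ, (z.val : ℤ) = 4 * a + x + 2 * n * c ∧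
          -(n : ℤ) ≤ x ∧ x < n := by
        by_cases c1 : (z.val : ℤ) - 4 * a < -n
        · exact ⟨z.val - 4 * a + 2 * n, -1, by ring, by omega, by omega⟩
        by_cases c2 : (z.val : ℤ) - 4 * a < n
        · exact ⟨z.val - 4 * a, 0, by ring, by omega, by omega⟩
        · exact ⟨z.val - 4 * a - 2 * n, 1, by ring, by omega, by omega⟩
      have hzx : z = ((4 * a + x : ℤ) : ZMod (2 * n)) := by
        have h5 : ((z.val : ℤ) : ZMod (2 * n)) = z := by simp
        rw [← h5, ZMod.intCast_eq_intCast_iff_dvd_sub]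
        exact ⟨-c, by rw [hxc]; push_cast; ring⟩
      have hx4 : x % 4 = 2 ∨ x % 4 = 3 := by
        have := val_mod_four n hn ⟨2 * m, by omega⟩ (4 * a + x)
        rw [← hzx] at this
        omega
      have : ∃ t ∈ S, xx t = x := by
        by_cases hx0 : 0 ≤ x
        · refine ⟨((x / 4).toNat, true, decide (x % 4 = 3)), ?_, ?_⟩
          · simp [hS]; omega
          · rcases hx4 with h | h <;> simp [xx, h] <;> omega
        · refine ⟨((-(x / 4) - 1).toNat, false, decide (x % 4 = 3)), ?_, ?_⟩
          · simp [hS]; omega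
          · rcases hx4 with h | h <;> simp [xx, h] <;> omega
      obtain ⟨t, ht, htx⟩ := this
      refine ⟨t, ht, ?_⟩
      simp only [hg, htx]
      exact Prod.ext (Fin.ext (by simp [hi])) hzx.symm
  rw [← finsum_mem_eq_of_bijOn g hbij (f := fun t => ((FF b p (xx t) : ℤ) : ℚ))
    (g := fun y => ((AT n p).dist u y : ℚ))]
  · rw [finsum_mem_coe_finset, ← Int.cast_sum, hS, sum_FF p m (by omega) b hb, hm]
    push_cast; ring
  · rintro ⟨l, s, e⟩ ht
    simp [hS] at ht
    rw [hulast, ← dist_eq n p m hm hgt a b hb]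
    · simp [hg]
    · cases s <;> cases e <;> simp [xx] <;> omega
end
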